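/- (Epsilon-net sampling for visibility) Let (X,R) be a finite set system of VC dimension at most d and fix δ ∈ (0,1), p ∈ (0,1). A multiset Y of independent uniform samples from X of size at least max{(4/δ)·log₂(2/p), (8d/δ)·log₂(8d/δ)} is, with probability at least 1−p, a δ-net: for every R ∈ R with Card(X ∩ R) ≥ δ·Card(X), we have Y ∩ R ≠ ∅. -/

import Mathlib

/-- `Y` is shattered by the family `R`: every subset of `Y` is a trace `Y ∩ r`. -/
def ShattersFam {α : Type*} (R : Set (Set α)) (Y : Set α) : Prop :=
  ∀ Z ⊆ Y, ∃ r ∈ R, Y ∩ r = Z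

open Finset in
lemma enet_card_small {β : Type*} [DecidableEq β] (S : Finset β) (d : ℕ) :
    #(S.powerset.filter (fun s => #s ≤ d)) ≤ (#S + 1) ^ d := by
  induction d with
  | zero =>
    have : S.powerset.filter (fun s => #s ≤ 0) ⊆ {∅} := by
      intro s hs
      simpa using (Finset.mem_filter.1 hs).2
    simpa using Finset.card_le_card this
  | succ d ih =>
    have hsub : S.powerset.filter (fun s => #s ≤ d + 1) ⊆
        ((insertNone S) ×ˢ (S.powerset.filter (fun s => #s ≤ d))).image
          (fun q => q.1.elim q.2 (fun a => insert a q.2)) := by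
      intro s hs
      rw [Finset.mem_filter, Finset.mem_powerset] at hs
      rw [Finset.mem_image]
      rcases s.eq_empty_or_nonempty with rfl | ⟨a, ha⟩
      · exact ⟨(none, ∅), by simp, rfl⟩
      · refine ⟨(some a, s.erase a), ?_, by simp [Finset.insert_erase ha]⟩
        have h1 : #(s.erase a) ≤ d := by
          rw [Finset.card_erase_of_mem ha]; omega
        simp [hs.1 ha, h1, (Finset.erase_subset a s).trans hs.1]
    calc _ ≤ _ := Finset.card_le_card hsub
      _ ≤ _ := Finset.card_image_le
      _ = (#S + 1) * #(S.powerset.filter (fun s => #s ≤ d)) := by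
        rw [Finset.card_product, Finset.card_insertNone]
      _ ≤ (#S + 1) * (#S + 1) ^ d := by gcongr
      _ = _ := by ring

open Finset in
lemma enet_traces {β : Type*} [DecidableEq β] (𝒜 : Finset (Finset β)) (d : ℕ)
    (h : ∀ s, 𝒜.Shatters s → #s ≤ d) (S : Finset β) :
    #(𝒜.image (fun t => S ∩ t)) ≤ (#S + 1) ^ d := by
  refine (Finset.card_le_card_shatterer _).trans
    ((Finset.card_le_card ?_).trans (enet_card_small S d))
  intro s hs
  rw [Finset.mem_shatterer] at hs
  have hsS : s ⊆ S := by
    obtain ⟨t, ht, hst⟩ := hs.exists_superset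
    obtain ⟨u, hu, rfl⟩ := Finset.mem_image.1 ht
    exact hst.trans Finset.inter_subset_left
  rw [Finset.mem_filter, Finset.mem_powerset]
  refine ⟨hsS, h s ?_⟩
  intro t ht
  obtain ⟨u, hu, hut⟩ := hs ht
  obtain ⟨v, hv, rfl⟩ := Finset.mem_image.1 hu
  refine ⟨v, hv, ?_⟩
  rw [← hut, ← Finset.inter_assoc, Finset.inter_eq_left.2 hsS]

lemma enet_moment {β : Type*} [Fintype β] (f : β → ℝ) (v : ℝ)
    (h0 : ∑ b, f b = 0) (h2 : ∑ b, f b ^ 2 = Fintype.card β * v) (M : ℕ) (c : ℝ) :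
    ∑ z : Fin M → β, (∑ i, f (z i) + c) ^ 2 = (Fintype.card β : ℝ) ^ M * (c ^ 2 + M * v) := by
  induction M generalizing c with
  | zero => simp
  | succ M ih =>
    rw [← (Fin.consEquiv (fun _ => β)).sum_comp, Fintype.sum_prod_type]
    have : ∀ b : β, ∑ z : Fin M → β,
        (∑ i, f ((Fin.consEquiv (fun _ : Fin (M+1) => β)) (b, z) i) + c) ^ 2 =
        (Fintype.card β : ℝ) ^ M * ((f b + c) ^ 2 + M * v) := by
      intro b
      rw [← ih]
      refine Finset.sum_congr rfl fun z _ => ?_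
      rw [Fin.sum_univ_succ]
      simp [Fin.consEquiv]
      ring
    simp_rw [this]
    rw [← Finset.mul_sum]
    have e : ∑ b, ((f b + c) ^ 2 + M * v) =
        ∑ b, f b ^ 2 + 2 * c * ∑ b, f b + Fintype.card β * (c ^ 2 + M * v) := by
      have e0 : (Fintype.card β : ℝ) * (c ^ 2 + M * v) = ∑ _b : β, (c ^ 2 + M * v) := by
        rw [Finset.sum_const, Finset.card_univ, nsmul_eq_mul]
      rw [e0, Finset.mul_sum, ← Finset.sum_add_distrib, ← Finset.sum_add_distrib]
      refine Finset.sum_congr rfl fun b _ => ?_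
      ring
    rw [e, h0, h2]
    push_cast
    ring

open Finset in
lemma enet_cheb {β : Type*} [Fintype β] [DecidableEq β] [Nonempty β] (t : Finset β) (δ : ℝ)
    (M : ℕ) (hδ : 0 < δ) (hM : 4 ≤ δ * M) (ht : δ * Fintype.card β ≤ #t) :
    (Fintype.card β : ℝ) ^ M ≤
      2 * #{z : Fin M → β | δ * M / 2 ≤ (#{i | z i ∈ t} : ℝ)} := by
  classical
  set n : ℝ := ((Fintype.card β : ℕ) : ℝ) with hn
  have hn0 : 0 < n := by rw [hn]; exact_mod_cast Fintype.card_pos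
  set q : ℝ := #t / n with hq
  have hqn : (#t : ℝ) = n * q := by rw [hq]; field_simp
  have hqδ : δ ≤ q := by rw [hq, le_div_iff₀ hn0]; exact ht
  set f : β → ℝ := fun b => (if b ∈ t then 1 else 0) - q with hf
  have h0 : ∑ b, f b = 0 := by
    simp [hf, Finset.sum_sub_distrib, ← hn]
    linarith
  have h2 : ∑ b, f b ^ 2 = Fintype.card β * (q * (1 - q)) := by
    have : ∀ b, f b ^ 2 = (if b ∈ t then 1 else 0) * (1 - 2 * q) + q ^ 2 := by
      intro b; simp only [hf]; split_ifs <;> ring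
    simp_rw [this]
    rw [Finset.sum_add_distrib, ← Finset.sum_mul]
    simp [← hn]
    rw [hqn]; ring
  have key := enet_moment f (q * (1 - q)) h0 h2 M (-2)
  set G : Finset (Fin M → β) := {z : Fin M → β | δ * M / 2 ≤ (#{i | z i ∈ t} : ℝ)} with hG
  have hcard : (#G : ℝ) + #Gᶜ = n ^ M := by
    rw [hn]; exact_mod_cast (by rw [Finset.card_add_card_compl]; simp : #G + #Gᶜ = Fintype.card β ^ M)
  have hM0 : (0:ℝ) ≤ M := by positivity
  set μ : ℝ := M * q with hμ
  have hμ4 : δ * M ≤ μ := by rw [hμ]; nlinarith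
  have hlow : (#Gᶜ : ℝ) * (μ / 2 + 2) ^ 2 ≤ n ^ M * ((-2) ^ 2 + M * (q * (1 - q))) := by
    rw [hn, ← key, ← nsmul_eq_mul]
    refine le_trans (Finset.card_nsmul_le_sum Gᶜ (fun z => (∑ i, f (z i) + -2) ^ 2) _ ?_)
      (Finset.sum_le_sum_of_subset_of_nonneg (Finset.subset_univ _) fun _ _ _ => sq_nonneg _)
    intro z hz
    have hz' : (#{i | z i ∈ t} : ℝ) < δ * M / 2 := by
      simpa [hG] using hz
    have hs : ∑ i, f (z i) = (#{i | z i ∈ t} : ℝ) - μ := by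
      simp [hf, Finset.sum_sub_distrib, hμ]
    rw [hs]
    nlinarith
  have hup : n ^ M * ((-2) ^ 2 + M * (q * (1 - q))) ≤ n ^ M * (μ + 4) := by
    refine mul_le_mul_of_nonneg_left ?_ (by positivity)
    rw [hμ]; nlinarith [mul_nonneg hM0 (sq_nonneg q)]
  have h3 : (#Gᶜ : ℝ) * (μ + 4) ≤ 4 * n ^ M := by
    have : 0 < μ + 4 := by linarith
    have h4 : (#Gᶜ : ℝ) * (μ + 4) * (μ + 4) ≤ 4 * n ^ M * (μ + 4) := by nlinarith
    exact le_of_mul_le_mul_right h4 this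
  have h5 : (#Gᶜ : ℝ) * 8 ≤ (#Gᶜ : ℝ) * (μ + 4) :=
    mul_le_mul_of_nonneg_left (by linarith) (Nat.cast_nonneg _)
  linarith

/-- coordinatewise swap -/
def enetSwap {β : Type*} {M : ℕ} (s : Fin M → Bool) (w : Fin M → β × β) : Fin M → β × β :=
  fun i => if s i then (w i).swap else w i

lemma enetSwap_invol {β : Type*} {M : ℕ} (s : Fin M → Bool) :
    Function.Involutive (enetSwap (β := β) s) := by
  intro w; funext i; simp only [enetSwap]; split_ifs <;> simp

open Finset in
lemma enet_one {β : Type*} [DecidableEq β] {M : ℕ} (w : Fin M → β × β) (t : Finset β) (k : ℝ) :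
    (#{s : Fin M → Bool | (∀ i, (enetSwap s w i).1 ∉ t) ∧
      k ≤ (#{i | (enetSwap s w i).2 ∈ t} : ℝ)} : ℝ) * (2:ℝ) ^ k ≤ 2 ^ M := by
  classical
  set A : Finset (Fin M → Bool) := {s : Fin M → Bool | (∀ i, (enetSwap s w i).1 ∉ t) ∧
      k ≤ (#{i | (enetSwap s w i).2 ∈ t} : ℝ)} with hA
  rcases A.eq_empty_or_nonempty with h | ⟨s, hs⟩
  · simp [h]
  set h : Fin M → ℕ := fun i => (if (w i).1 ∈ t then 1 else 0) + (if (w i).2 ∈ t then 1 else 0)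
    with hh
  have hk : k ≤ (∑ i, h i : ℕ) := by
    rw [hA, Finset.mem_filter] at hs
    refine hs.2.2.trans ?_
    rw [Finset.card_filter]
    norm_cast
    refine Finset.sum_le_sum fun i _ => ?_
    simp only [hh, enetSwap]
    split_ifs <;> simp_all
  have hsub : A ⊆ Fintype.piFinset (fun i => ({b : Bool | (if b then (w i).swap else w i).1 ∉ t} : Finset Bool)) := by
    intro s hs
    rw [hA, Finset.mem_filter] at hs
    rw [Fintype.mem_piFinset]
    intro i
    simpa [enetSwap] using hs.2.1 i
  have hcard : #A * 2 ^ (∑ i, h i) ≤ 2 ^ M := by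
    calc #A * 2 ^ (∑ i, h i) ≤ (∏ i, #({b : Bool | (if b then (w i).swap else w i).1 ∉ t} : Finset Bool)) * ∏ i, 2 ^ h i := by
          rw [← Fintype.card_piFinset, Finset.prod_pow_eq_pow_sum]
          exact Nat.mul_le_mul_right _ (Finset.card_le_card hsub)
      _ = ∏ i, (#({b : Bool | (if b then (w i).swap else w i).1 ∉ t} : Finset Bool) * 2 ^ h i) := by
          rw [Finset.prod_mul_distrib]
      _ ≤ ∏ _i : Fin M, 2 := by
          refine Finset.prod_le_prod' fun i _ => ?_
          rw [Finset.card_filter, Fintype.sum_bool]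
          simp only [hh]
          by_cases h1 : (w i).1 ∈ t <;> by_cases h2 : (w i).2 ∈ t <;> simp [h1, h2]
      _ = 2 ^ M := by simp
  calc (#A : ℝ) * (2:ℝ) ^ k ≤ #A * (2:ℝ) ^ (((∑ i, h i : ℕ)) : ℝ) := by
        gcongr; norm_num
    _ = #A * (2:ℝ) ^ (∑ i, h i) := by rw [Real.rpow_natCast]
    _ ≤ 2 ^ M := by exact_mod_cast hcard

open Finset in
lemma enet_double {β : Type*} [Fintype β] [DecidableEq β] (𝒜 : Finset (Finset β)) (d : ℕ)
    (h : ∀ s, 𝒜.Shatters s → #s ≤ d) (M : ℕ) (k : ℝ) :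
    (#{w : Fin M → β × β | ∃ t ∈ 𝒜, (∀ i, (w i).1 ∉ t) ∧ k ≤ (#{i | (w i).2 ∈ t} : ℝ)} : ℝ)
      * (2:ℝ) ^ k ≤ (2 * M + 1) ^ d * ((Fintype.card β : ℝ) ^ M * (Fintype.card β : ℝ) ^ M) := by
  classical
  set P : (Fin M → β × β) → Prop :=
    fun w => ∃ t ∈ 𝒜, (∀ i, (w i).1 ∉ t) ∧ k ≤ (#{i | (w i).2 ∈ t} : ℝ) with hP
  have hw : ∀ w : Fin M → β × β,
      (#{s : Fin M → Bool | P (enetSwap s w)} : ℝ) * 2 ^ k ≤ (2 * M + 1) ^ d * 2 ^ M := by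
    intro w
    set S : Finset β := univ.image (fun q : Fin M × Bool => if q.2 then (w q.1).1 else (w q.1).2)
      with hS
    have hSc : #S ≤ 2 * M := by
      refine Finset.card_image_le.trans ?_
      simp [mul_comm]
    have hS1 : ∀ i, (w i).1 ∈ S := fun i => Finset.mem_image.2 ⟨(i, true), by simp, by simp⟩
    have hS2 : ∀ i, (w i).2 ∈ S := fun i => Finset.mem_image.2 ⟨(i, false), by simp, by simp⟩
    have hS1' : ∀ s i, (enetSwap s w i).1 ∈ S := by
      intro s i; simp only [enetSwap]; split_ifs <;> simp [hS1, hS2]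
    have hS2' : ∀ s i, (enetSwap s w i).2 ∈ S := by
      intro s i; simp only [enetSwap]; split_ifs <;> simp [hS1, hS2]
    have hsub : ({s : Fin M → Bool | P (enetSwap s w)} : Finset _) ⊆
        (𝒜.image (fun t => S ∩ t)).biUnion (fun t => {s : Fin M → Bool |
          (∀ i, (enetSwap s w i).1 ∉ t) ∧ k ≤ (#{i | (enetSwap s w i).2 ∈ t} : ℝ)}) := by
      intro s hs
      obtain ⟨t, ht, h1, h2⟩ := (Finset.mem_filter.1 hs).2
      rw [Finset.mem_biUnion]
      refine ⟨S ∩ t, Finset.mem_image_of_mem _ ht, ?_⟩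
      simp only [Finset.mem_filter, Finset.mem_univ, true_and, Finset.mem_inter, hS1', hS2']
      exact ⟨h1, h2⟩
    have hc := (Finset.card_le_card hsub).trans Finset.card_biUnion_le
    have htr : (#(𝒜.image (fun t => S ∩ t)) : ℝ) ≤ (2 * M + 1) ^ d := by
      have := (enet_traces 𝒜 d h S).trans (Nat.pow_le_pow_left (Nat.succ_le_succ hSc) d)
      exact_mod_cast this
    calc (#{s : Fin M → Bool | P (enetSwap s w)} : ℝ) * 2 ^ k
        ≤ (∑ t ∈ 𝒜.image (fun t => S ∩ t), (#{s : Fin M → Bool |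
          (∀ i, (enetSwap s w i).1 ∉ t) ∧ k ≤ (#{i | (enetSwap s w i).2 ∈ t} : ℝ)} : ℝ)) * 2 ^ k := by
          gcongr
          exact_mod_cast hc
      _ ≤ ∑ t ∈ 𝒜.image (fun t => S ∩ t), (2:ℝ) ^ M := by
          rw [Finset.sum_mul]
          exact Finset.sum_le_sum fun t _ => enet_one w t k
      _ = #(𝒜.image (fun t => S ∩ t)) * (2:ℝ) ^ M := by simp
      _ ≤ _ := by gcongr
  have hdc : ∑ w : Fin M → β × β, #{s : Fin M → Bool | P (enetSwap s w)} =
      2 ^ M * #{w | P w} := by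
    simp_rw [Finset.card_filter]
    rw [Finset.sum_comm]
    have : ∀ s : Fin M → Bool, ∑ w : Fin M → β × β, (if P (enetSwap s w) then 1 else 0) =
        ∑ w, if P w then 1 else 0 := fun s =>
      Equiv.sum_comp ((enetSwap_invol s).toPerm) (fun w => if P w then 1 else 0)
    simp_rw [this]
    simp
  have hfin : ((2:ℝ) ^ M * #{w | P w}) * 2 ^ k ≤
      (Fintype.card β : ℝ) ^ M * (Fintype.card β : ℝ) ^ M * ((2 * M + 1) ^ d * 2 ^ M) := by
    have e : ((2:ℝ) ^ M * #{w | P w}) =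
      ∑ w : Fin M → β × β, (#{s : Fin M → Bool | P (enetSwap s w)} : ℝ) := by exact_mod_cast hdc.symm
    rw [e, Finset.sum_mul]
    refine (Finset.sum_le_sum fun w _ => hw w).trans (le_of_eq ?_)
    simp [mul_pow]
  have h2 : (0:ℝ) < 2 ^ M := by positivity
  refine le_of_mul_le_mul_left ?_ h2
  calc _ = ((2:ℝ) ^ M * #{w | P w}) * 2 ^ k := by ring
    _ ≤ _ := hfin
    _ = _ := by ring

open Finset in
lemma enet_symm {β : Type*} [Fintype β] [DecidableEq β] [Nonempty β] (𝒜 : Finset (Finset β))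
    (δ : ℝ) (M : ℕ) (hδ : 0 < δ) (hM : 4 ≤ δ * M) :
    (#{y : Fin M → β | ∃ t ∈ 𝒜, δ * Fintype.card β ≤ #t ∧ ∀ i, y i ∉ t} : ℝ) *
      (Fintype.card β : ℝ) ^ M ≤
    2 * #{w : Fin M → β × β | ∃ t ∈ 𝒜, (∀ i, (w i).1 ∉ t) ∧
      δ * M / 2 ≤ (#{i | (w i).2 ∈ t} : ℝ)} := by
  classical
  set P : (Fin M → β × β) → Prop := fun w => ∃ t ∈ 𝒜, (∀ i, (w i).1 ∉ t) ∧
      δ * M / 2 ≤ (#{i | (w i).2 ∈ t} : ℝ) with hP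
  set B : Finset (Fin M → β) := {y : Fin M → β | ∃ t ∈ 𝒜, δ * Fintype.card β ≤ #t ∧ ∀ i, y i ∉ t}
    with hB
  have h1 : ∀ y ∈ B, (Fintype.card β : ℝ) ^ M ≤
      2 * #{z : Fin M → β | P (fun i => (y i, z i))} := by
    intro y hy
    obtain ⟨t, ht, htc, hyt⟩ := (Finset.mem_filter.1 hy).2
    refine (enet_cheb t δ M hδ hM htc).trans ?_
    gcongr with z
    intro hz
    exact ⟨t, ht, hyt, hz⟩
  have h2 : ∑ y : Fin M → β, #{z : Fin M → β | P (fun i => (y i, z i))} = #{w | P w} := by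
    simp_rw [Finset.card_filter]
    rw [← Fintype.sum_prod_type']
    refine Fintype.sum_equiv (Equiv.arrowProdEquivProdArrow (Fin M) (fun _ => β) (fun _ => β)).symm
      _ _ fun q => ?_
    rfl
  have gen : ∀ (N : (Fin M → β) → ℕ) (K : ℝ) (W : ℕ), (∀ y ∈ B, K ≤ 2 * (N y : ℝ)) →
      ∑ y, N y = W → (#B : ℝ) * K ≤ 2 * (W : ℝ) := by
    intro N K W hK hW
    have e1 : (#B : ℝ) * K = ∑ y ∈ B, K := by rw [Finset.sum_const, nsmul_eq_mul]
    have e2 : ∑ y ∈ B, K ≤ ∑ y ∈ B, 2 * (N y : ℝ) := Finset.sum_le_sum hK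
    have e3 : ∑ y ∈ B, 2 * (N y : ℝ) ≤ ∑ y, 2 * (N y : ℝ) :=
      Finset.sum_le_sum_of_subset_of_nonneg (Finset.subset_univ B) fun _ _ _ =>
        mul_nonneg zero_le_two (Nat.cast_nonneg _)
    have e4 : ∑ y, 2 * (N y : ℝ) = 2 * (W : ℝ) := by
      rw [← Finset.mul_sum, ← hW, Nat.cast_sum]
    linarith
  have h4 := gen _ _ _ h1 h2
  convert h4 using 3

lemma enet_exp {u : ℝ} (hu : 3 ≤ u) : 2 * u * 2 ^ u + 1 ≤ (2:ℝ) ^ u * 2 ^ u := by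
  have h1 : 1 + (u - 3) * Real.log 2 ≤ (2:ℝ) ^ (u - 3) := by
    rw [Real.rpow_def_of_pos (by norm_num)]
    linarith [Real.add_one_le_exp (Real.log 2 * (u - 3))]
  have h2 : (2:ℝ) ^ u = 8 * 2 ^ (u - 3) := by
    rw [Real.rpow_sub (by norm_num)]; norm_num; ring
  have h3 := Real.log_two_gt_d9
  have h4 : 2 * u + 2 ≤ (2:ℝ) ^ u := by rw [h2]; nlinarith
  nlinarith

lemma enet_num (d M : ℕ) (δ p : ℝ) (hδ : δ ∈ Set.Ioo (0 : ℝ) 1) (hp : p ∈ Set.Ioo (0 : ℝ) 1)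
    (hM : max (4 / δ * Real.logb 2 (2 / p)) (8 * d / δ * Real.logb 2 (8 * d / δ)) ≤ (M : ℝ)) :
    4 ≤ δ * M ∧ 2 * (2 * (M:ℝ) + 1) ^ d ≤ p * (2:ℝ) ^ (δ * M / 2) := by
  obtain ⟨hδ0, hδ1⟩ := hδ
  obtain ⟨hp0, hp1⟩ := hp
  obtain ⟨hM1, hM2⟩ := max_le_iff.1 hM
  have hL : 4 * Real.logb 2 (2 / p) ≤ δ * M := by
    have := mul_le_mul_of_nonneg_left hM1 hδ0.le
    calc _ = δ * (4 / δ * Real.logb 2 (2 / p)) := by field_simp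
      _ ≤ _ := this
  have hl1 : 1 ≤ Real.logb 2 (2 / p) := by
    rw [Real.le_logb_iff_rpow_le (by norm_num) (by positivity), Real.rpow_one, le_div_iff₀ hp0]
    linarith
  refine ⟨by linarith, ?_⟩
  have ha : 2 / p ≤ (2:ℝ) ^ (δ * M / 4) := by
    rw [← Real.logb_le_iff_le_rpow (by norm_num) (by positivity)]
    linarith
  have hb : (2 * (M:ℝ) + 1) ^ d ≤ (2:ℝ) ^ (δ * M / 4) := by
    rcases Nat.eq_zero_or_pos d with rfl | hd
    · simp only [pow_zero]
      exact Real.one_le_rpow (by norm_num) (by positivity)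
    · have hd1 : (1:ℝ) ≤ d := by exact_mod_cast hd
      set x : ℝ := 8 * d / δ with hx
      have hx8 : 8 ≤ x := by rw [hx, le_div_iff₀ hδ0]; nlinarith
      have hx0 : 0 < x := by linarith
      set u : ℝ := M / x with hu
      have hMu : (M:ℝ) = x * u := by rw [hu]; field_simp
      have hxu : Real.logb 2 x ≤ u := by rw [hu, le_div_iff₀ hx0]; linarith
      have hx2 : x ≤ 2 ^ u := (Real.logb_le_iff_le_rpow (by norm_num) hx0).1 hxu
      have hu3 : 3 ≤ u := by
        refine le_trans ?_ hxu
        rw [Real.le_logb_iff_rpow_le (by norm_num) hx0]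
        norm_num; exact hx8
      have e : δ * M / 4 = (u + u) * d := by
        rw [hMu, hx]; field_simp; ring
      rw [e, Real.rpow_mul (by norm_num), Real.rpow_natCast, Real.rpow_add (by norm_num)]
      refine pow_le_pow_left₀ (by positivity) ?_ d
      refine le_trans ?_ (enet_exp hu3)
      rw [hMu]; nlinarith
  have e : (2:ℝ) ^ (δ * M / 2) = 2 ^ (δ * M / 4) * 2 ^ (δ * M / 4) := by
    rw [← Real.rpow_add (by norm_num)]; congr 1; ring
  rw [e]
  rw [div_le_iff₀ hp0] at ha
  calc 2 * (2 * (M:ℝ) + 1) ^ d ≤ (2 ^ (δ * M / 4) * p) * 2 ^ (δ * M / 4) := by gcongr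
    _ = _ := by ring

open Finset in
lemma enet_core {β : Type*} [Fintype β] [DecidableEq β] [Nonempty β] (𝒜 : Finset (Finset β))
    (d M : ℕ) (h : ∀ s, 𝒜.Shatters s → #s ≤ d) (δ p : ℝ) (hδ : 0 < δ) (h4 : 4 ≤ δ * M)
    (hn : 2 * (2 * (M:ℝ) + 1) ^ d ≤ p * (2:ℝ) ^ (δ * M / 2)) :
    (1 - p) * (Fintype.card β : ℝ) ^ M ≤
      #{y : Fin M → β | ∀ t ∈ 𝒜, δ * Fintype.card β ≤ #t → ∃ i, y i ∈ t} := by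
  classical
  have h1 := enet_symm 𝒜 δ M hδ h4
  have h2 := enet_double 𝒜 d h M (δ * M / 2)
  set n : ℝ := ((Fintype.card β : ℕ) : ℝ) with hnn
  have hn0 : 0 < n := by rw [hnn]; exact_mod_cast Fintype.card_pos
  set B : Finset (Fin M → β) := {y : Fin M → β | ∃ t ∈ 𝒜, δ * n ≤ #t ∧ ∀ i, y i ∉ t} with hB
  set G : Finset (Fin M → β) := {y : Fin M → β | ∀ t ∈ 𝒜, δ * n ≤ #t → ∃ i, y i ∈ t} with hG
  have hGB : G = Bᶜ := by
    ext y; simp [hG, hB]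
  have hc : (#B : ℝ) + #G = n ^ M := by
    rw [hGB, hnn]
    exact_mod_cast (by rw [Finset.card_add_card_compl]; simp : #B + #Bᶜ = Fintype.card β ^ M)
  set W : ℝ := (2:ℝ) ^ (δ * M / 2) with hW
  have hW0 : 0 < W := by positivity
  have hNM : 0 < n ^ M := by positivity
  have h3 : (#B : ℝ) * (n ^ M * W) ≤ (p * n ^ M) * (n ^ M * W) := by
    calc (#B : ℝ) * (n ^ M * W) = (#B * n ^ M) * W := by ring
      _ ≤ _ := mul_le_mul_of_nonneg_right h1 hW0.le
      _ ≤ 2 * ((2 * (M:ℝ) + 1) ^ d * (n ^ M * n ^ M)) := by rw [mul_assoc]; gcongr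
      _ = (2 * (2 * (M:ℝ) + 1) ^ d) * (n ^ M * n ^ M) := by ring
      _ ≤ (p * W) * (n ^ M * n ^ M) := by gcongr
      _ = _ := by ring
  have h5 := le_of_mul_le_mul_right h3 (by positivity)
  linarith

theorem stmt14 {α : Type*} (X : Finset α) (hX : X.Nonempty) (R : Set (Set α)) (d : ℕ)
    (hVC : ∀ Y : Finset α, ShattersFam R (↑Y : Set α) → Y.card ≤ d)
    (δ p : ℝ) (hδ : δ ∈ Set.Ioo (0 : ℝ) 1) (hp : p ∈ Set.Ioo (0 : ℝ) 1)
    (M : ℕ)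
    (hM : max (4 / δ * Real.logb 2 (2 / p)) (8 * d / δ * Real.logb 2 (8 * d / δ))
      ≤ (M : ℝ)) :
    (1 - p) * (X.card : ℝ) ^ M ≤
      ({y : Fin M → α | (∀ i, y i ∈ X) ∧
        ∀ r ∈ R, δ * X.card ≤ (((↑X : Set α) ∩ r).ncard : ℝ) → ∃ i, y i ∈ r}.ncard : ℝ) := by
  classical
  obtain ⟨h4, hn⟩ := enet_num d M δ p hδ hp hM
  have : Nonempty X := hX.to_subtype
  let tr : Set α → Finset X := fun r => Finset.univ.filter (fun x : X => (x : α) ∈ r)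
  let 𝒜 : Finset (Finset X) := Finset.univ.filter (fun t => ∃ r ∈ R, t = tr r)
  have htr : ∀ r, ((X : Set α) ∩ r).ncard = (tr r).card := by
    intro r
    have : (X : Set α) ∩ r = ((tr r).map (Function.Embedding.subtype _) : Finset α) := by
      ext a; simp [tr, and_comm]
    rw [this, Set.ncard_coe_finset, Finset.card_map]
  have hsh : ∀ s, 𝒜.Shatters s → s.card ≤ d := by
    intro s hs
    rw [← Finset.card_map (Function.Embedding.subtype _)]
    apply hVC
    intro Z hZ
    obtain ⟨u, hu, hsu⟩ := hs (Finset.filter_subset (fun x : X => (x : α) ∈ Z) s)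
    obtain ⟨r, hr, rfl⟩ := (Finset.mem_filter.1 hu).2
    refine ⟨r, hr, ?_⟩
    have hiff : ∀ x : X, x ∈ s → ((x : α) ∈ r ↔ (x : α) ∈ Z) := by
      intro x hx
      have := Finset.ext_iff.1 hsu x
      simpa [tr, hx] using this
    ext a
    constructor
    · rintro ⟨ha, har⟩
      obtain ⟨x, hx, rfl⟩ := Finset.mem_map.1 (Finset.mem_coe.1 ha)
      exact (hiff x hx).1 har
    · intro haZ
      have ha := hZ haZ
      refine ⟨ha, ?_⟩
      obtain ⟨x, hx, rfl⟩ := Finset.mem_map.1 (Finset.mem_coe.1 ha)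
      exact (hiff x hx).2 haZ
  have key := enet_core 𝒜 d M hsh δ p hδ.1 h4 hn
  rw [Fintype.card_coe] at key
  refine key.trans ?_
  have hfin : {y : Fin M → α | (∀ i, y i ∈ X) ∧
        ∀ r ∈ R, δ * X.card ≤ (((↑X : Set α) ∩ r).ncard : ℝ) → ∃ i, y i ∈ r}.Finite := by
    refine (Fintype.piFinset (fun _ : Fin M => X)).finite_toSet.subset ?_
    intro y hy
    simpa using hy.1
  norm_cast
  rw [← Set.ncard_coe_finset]
  refine Set.ncard_le_ncard_of_injOn (fun y i => (y i : α)) ?_ ?_ hfin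
  · intro y hy
    have hy' := (Finset.mem_filter.1 (Finset.mem_coe.1 hy)).2
    refine ⟨fun i => (y i).2, fun r hr hc => ?_⟩
    rw [htr] at hc
    obtain ⟨i, hi⟩ := hy' (tr r) (Finset.mem_filter.2 ⟨Finset.mem_univ _, r, hr, rfl⟩) hc
    exact ⟨i, (Finset.mem_filter.1 hi).2⟩
  · intro y _ z _ hyz
    funext i
    exact Subtype.ext (congrFun hyz i)
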